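/- Let J = Heis(F_q) ⋊ D where D = {diag(u,v,u) : u,v ∈ F_q^×} ≅ F_q^× × F_q^× acts on the Heisenberg group E of matrices [[1,s₁,z],[0,1,s₂],[0,0,1]] by conjugation inside GL_3(F_q). Suppose gcd(q, |D|) = 1. Then the representation zeta function of J is ζ_J(s) = (q-1)[ (q-1) + (q+1)(q-1)^{-s} + (q-1)(q-1) q^{-s} ]. -/

import Mathlib

/-- The Heisenberg group `Heis F`: coordinates `(a, b, c)` for the unitriangular matrix
`[[1, a, c], [0, 1, b], [0, 0, 1]]`. -/
@[ext]
structure Heis (F : Type*) where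
  a : F
  b : F
  c : F

namespace Heis

variable {F : Type*} [Field F]

instance : Mul (Heis F) :=
  ⟨fun x y => ⟨x.a + y.a, x.b + y.b, x.c + y.c + x.a * y.b⟩⟩

instance : One (Heis F) := ⟨⟨0, 0, 0⟩⟩

instance : Inv (Heis F) := ⟨fun x => ⟨-x.a, -x.b, -x.c + x.a * x.b⟩⟩

@[simp] theorem mul_a (x y : Heis F) : (x * y).a = x.a + y.a := rfl
@[simp] theorem mul_b (x y : Heis F) : (x * y).b = x.b + y.b := rfl
@[simp] theorem mul_c (x y : Heis F) : (x * y).c = x.c + y.c + x.a * y.b := rfl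
@[simp] theorem one_a : (1 : Heis F).a = 0 := rfl
@[simp] theorem one_b : (1 : Heis F).b = 0 := rfl
@[simp] theorem one_c : (1 : Heis F).c = 0 := rfl
@[simp] theorem inv_a (x : Heis F) : x⁻¹.a = -x.a := rfl
@[simp] theorem inv_b (x : Heis F) : x⁻¹.b = -x.b := rfl
@[simp] theorem inv_c (x : Heis F) : x⁻¹.c = -x.c + x.a * x.b := rfl

instance instGroup : Group (Heis F) where
  mul_assoc x y z := by ext <;> simp <;> ring
  one_mul x := by ext <;> simp
  mul_one x := by ext <;> simp
  inv_mul_cancel x := by ext <;> simp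

end Heis

/-- The action of `D = Fˣ × Fˣ` (the diagonal torus `diag(u, v, u)`) on the Heisenberg
group, given by `(s₁, s₂, z) ↦ (u⁻¹ v s₁, u v⁻¹ s₂, z)` — conjugation inside `GL₃(F)`. -/
def heisAct (F : Type*) [Field F] : Fˣ × Fˣ →* MulAut (Heis F) where
  toFun p :=
    { toFun := fun x => ⟨(p.1 : F)⁻¹ * (p.2 : F) * x.a, (p.1 : F) * (p.2 : F)⁻¹ * x.b, x.c⟩
      invFun := fun x => ⟨(p.1 : F) * (p.2 : F)⁻¹ * x.a, (p.1 : F)⁻¹ * (p.2 : F) * x.b, x.c⟩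
      left_inv := by
        intro x
        have h1 : (p.1 : F) ≠ 0 := p.1.ne_zero
        have h2 : (p.2 : F) ≠ 0 := p.2.ne_zero
        ext <;> field_simp <;> ring
      right_inv := by
        intro x
        have h1 : (p.1 : F) ≠ 0 := p.1.ne_zero
        have h2 : (p.2 : F) ≠ 0 := p.2.ne_zero
        ext <;> field_simp <;> ring
      map_mul' := by
        intro x y
        have h1 : (p.1 : F) ≠ 0 := p.1.ne_zero
        have h2 : (p.2 : F) ≠ 0 := p.2.ne_zero
        ext <;> simp <;> field_simp <;> ring }
  map_one' := by
    ext x <;> simp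
  map_mul' := by
    intro p q
    have h1 : (p.1 : F) ≠ 0 := p.1.ne_zero
    have h2 : (p.2 : F) ≠ 0 := p.2.ne_zero
    have h3 : (q.1 : F) ≠ 0 := q.1.ne_zero
    have h4 : (q.2 : F) ≠ 0 := q.2.ne_zero
    ext x <;> simp <;> field_simp <;> ring

/-! ### Uniqueness of the decomposition into simple factors -/

section Uniqueness

/-- A central idempotent of a simple ring is trivial. -/
theorem IsSimpleRing.eq_zero_or_one_of_central_idempotent {R : Type*} [Ring R] [IsSimpleRing R]
    {p : R} (hp : p ∈ Subring.center R) (hpp : p * p = p) : p = 0 ∨ p = 1 := by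
  by_cases h : p = 0
  · exact Or.inl h
  · obtain ⟨b, hb⟩ := (IsSimpleRing.isField_center R).mul_inv_cancel
      (a := ⟨p, hp⟩) (fun h' => h (congrArg Subtype.val h'))
    have hb' : p * (b : R) = 1 := congrArg Subtype.val hb
    right
    calc p = p * (p * b) := by rw [hb', mul_one]
      _ = 1 := by rw [← mul_assoc, hpp, hb']

variable {K ι κ : Type*} [Field K] [DecidableEq ι] [DecidableEq κ]
  {R : ι → Type*} {S : κ → Type*} [∀ i, Ring (R i)] [∀ j, Ring (S j)]
  [∀ i, Algebra K (R i)] [∀ j, Algebra K (S j)]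

theorem Pi.mul_single_one (w : ∀ i, R i) (i : ι) :
    w * Pi.single i 1 = Pi.single i (w i) := by
  funext k
  by_cases h : k = i
  · subst h; simp
  · simp [h]

theorem Pi.single_one_mul (w : ∀ i, R i) (i : ι) :
    Pi.single i 1 * w = Pi.single i (w i) := by
  funext k
  by_cases h : k = i
  · subst h; simp
  · simp [h]

theorem Pi.single_one_index_injective [∀ i, Nontrivial (R i)] {i k : ι}
    (h : (Pi.single i 1 : ∀ i, R i) = Pi.single k 1) : i = k := by
  by_contra hik
  simpa [hik] using congrFun h i

theorem AlgEquiv.map_single_one_apply_eq_zero_or_one [∀ j, IsSimpleRing (S j)]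
    (Φ : (∀ i, R i) ≃ₐ[K] ∀ j, S j) (i : ι) (j : κ) :
    Φ (Pi.single i 1) j = 0 ∨ Φ (Pi.single i 1) j = 1 := by
  apply IsSimpleRing.eq_zero_or_one_of_central_idempotent
  · rw [Subring.mem_center_iff]
    intro g
    obtain ⟨w, hw⟩ := Φ.surjective (Pi.single j g)
    have h : Φ (w * Pi.single i 1) = Φ (Pi.single i 1 * w) := by
      rw [Pi.mul_single_one, Pi.single_one_mul]
    rw [map_mul, map_mul, hw] at h
    simpa using congrFun h j
  · have h := congrFun (map_mul Φ (Pi.single i 1) (Pi.single i 1)) j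
    rw [Pi.mul_single_one, Pi.single_eq_same] at h
    exact h.symm

/-- An isomorphism between products of simple algebras permutes the identities of the factors. -/
theorem AlgEquiv.exists_map_single_one [∀ i, IsSimpleRing (R i)] [∀ j, IsSimpleRing (S j)]
    (Φ : (∀ i, R i) ≃ₐ[K] ∀ j, S j) (i : ι) :
    ∃ j, Φ (Pi.single i 1) = Pi.single j 1 := by
  have hne : Φ (Pi.single i 1) ≠ 0 := by
    rw [Ne, map_eq_zero_iff Φ Φ.injective, Pi.single_eq_zero_iff]
    exact one_ne_zero
  obtain ⟨j, hj⟩ := Function.ne_iff.mp hne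
  have hj1 : Φ (Pi.single i 1) j = 1 := (Φ.map_single_one_apply_eq_zero_or_one i j).resolve_left hj
  have key : Φ (Pi.single i (Φ.symm (Pi.single j 1) i)) = Pi.single j 1 := by
    rw [← Pi.mul_single_one, map_mul, Φ.apply_symm_apply, Pi.single_one_mul, hj1]
  refine ⟨j, ?_⟩
  rcases Φ.symm.map_single_one_apply_eq_zero_or_one j i with h | h
  · rw [h, Pi.single_zero, map_zero] at key
    exact absurd key.symm (by rw [Pi.single_eq_zero_iff]; exact one_ne_zero)
  · rwa [h] at key

theorem AlgEquiv.finrank_le_of_map_single_one (Φ : (∀ i, R i) ≃ₐ[K] ∀ j, S j) {i : ι} {j : κ}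
    [Module.Finite K (S j)] (h : Φ (Pi.single i 1) = Pi.single j 1) :
    Module.finrank K (R i) ≤ Module.finrank K (S j) := by
  let L : R i →ₗ[K] S j :=
    LinearMap.proj j ∘ₗ Φ.toLinearMap ∘ₗ LinearMap.single K R i
  refine LinearMap.finrank_le_finrank_of_injective (f := L) ?_
  rw [injective_iff_map_eq_zero]
  intro x hx
  have hx' : Φ (Pi.single i x) j = 0 := hx
  have hs : (Pi.single i 1 * Pi.single i x : ∀ i, R i) = Pi.single i x := by
    rw [Pi.single_one_mul, Pi.single_eq_same]
  have : Φ (Pi.single i x) = 0 := by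
    rw [← hs, map_mul, h, Pi.single_one_mul, hx', Pi.single_zero]
  rwa [map_eq_zero_iff Φ Φ.injective, Pi.single_eq_zero_iff] at this

/-- The dimensions of the simple factors are determined by the algebra. -/
theorem AlgEquiv.exists_equiv_finrank_eq [∀ i, IsSimpleRing (R i)] [∀ j, IsSimpleRing (S j)]
    [∀ i, Module.Finite K (R i)] [∀ j, Module.Finite K (S j)]
    (Φ : (∀ i, R i) ≃ₐ[K] ∀ j, S j) :
    ∃ σ : ι ≃ κ, ∀ i, Module.finrank K (R i) = Module.finrank K (S (σ i)) := by
  choose σ hσ using Φ.exists_map_single_one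
  choose τ hτ using Φ.symm.exists_map_single_one
  refine ⟨⟨σ, τ, fun i => Pi.single_one_index_injective (R := R) ?_, fun j =>
    Pi.single_one_index_injective (R := S) ?_⟩, fun i => le_antisymm ?_ ?_⟩
  · rw [← hτ, ← hσ, Φ.symm_apply_apply]
  · rw [← hσ, ← hτ, Φ.apply_symm_apply]
  · exact Φ.finrank_le_of_map_single_one (hσ i)
  · refine Φ.symm.finrank_le_of_map_single_one (j := i) ?_
    rw [Equiv.coe_fn_mk, ← hσ, Φ.symm_apply_apply]

/-- `Equiv.sumPiEquivProdPi` as an algebra equivalence. -/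
def AlgEquiv.sumPiEquivProdPi (K : Type*) [CommSemiring K] {α β : Type*} (A : α ⊕ β → Type*)
    [∀ k, Semiring (A k)] [∀ k, Algebra K (A k)] :
    (∀ k, A k) ≃ₐ[K] (∀ a, A (Sum.inl a)) × ∀ b, A (Sum.inr b) :=
  { Equiv.sumPiEquivProdPi A with
    map_mul' := fun _ _ => rfl
    map_add' := fun _ _ => rfl
    commutes' := fun _ => rfl }

end Uniqueness

/-! ### Fourier inversion on finite abelian groups -/

section Fourier

theorem AddChar.eq_zero_of_forall_sum_mul_eq_zero {A : Type*} [AddCommGroup A] [Fintype A]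
    {f : A → ℂ} (h : ∀ φ : AddChar A ℂ, ∑ x, f x * φ x = 0) (x : A) : f x = 0 := by
  classical
  have key : ∑ φ : AddChar A ℂ, (∑ y, f y * φ y) * φ (-x) = f x * Fintype.card A := by
    simp_rw [Finset.sum_mul]
    rw [Finset.sum_comm]
    simp_rw [mul_assoc, ← AddChar.map_add_eq_mul, ← Finset.mul_sum, AddChar.sum_apply_eq_ite,
      ← sub_eq_add_neg, sub_eq_zero]
    simp
  simp_rw [h, zero_mul, Finset.sum_const_zero] at key
  exact (mul_eq_zero.mp key.symm).resolve_right (Nat.cast_ne_zero.mpr Fintype.card_ne_zero)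

theorem AddChar.eq_zero_of_forall_sum_mul_ofMul_eq_zero {G : Type*} [CommGroup G] [Fintype G]
    {f : G → ℂ} (h : ∀ φ : AddChar (Additive G) ℂ, ∑ x, f x * φ (Additive.ofMul x) = 0) (x : G) :
    f x = 0 :=
  AddChar.eq_zero_of_forall_sum_mul_eq_zero (A := Additive G) (f := fun y => f y.toMul)
    (fun φ => (Fintype.sum_equiv Additive.toMul _ _ fun _ => rfl).trans (h φ)) (Additive.ofMul x)

variable {F : Type*} [Field F] [Fintype F] {ψ : AddChar F ℂ}

theorem AddChar.IsPrimitive.eq_zero_of_forall_sum_mul_eq_zero (hψ : ψ.IsPrimitive)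
    {f : F → ℂ} (h : ∀ γ : F, ∑ x, f x * ψ (γ * x) = 0) (x : F) : f x = 0 := by
  classical
  have key : ∑ γ : F, (∑ y, f y * ψ (γ * y)) * ψ (γ * -x) = f x * Fintype.card F := by
    simp_rw [Finset.sum_mul]
    rw [Finset.sum_comm]
    simp_rw [mul_assoc, ← AddChar.map_add_eq_mul, ← mul_add, ← Finset.mul_sum,
      AddChar.sum_mulShift _ hψ, ← sub_eq_add_neg, sub_eq_zero]
    simp
  simp_rw [h, zero_mul, Finset.sum_const_zero] at key
  exact (mul_eq_zero.mp key.symm).resolve_right (Nat.cast_ne_zero.mpr Fintype.card_ne_zero)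

theorem AddChar.exists_isPrimitive_complex (F : Type*) [Field F] [Finite F] :
    ∃ ψ : AddChar F ℂ, ψ.IsPrimitive := by
  obtain ⟨ψ, hψ⟩ := AddChar.exists_apply_ne_zero.mpr (one_ne_zero : (1 : F) ≠ 0)
  exact ⟨ψ, AddChar.IsPrimitive.of_ne_one (AddChar.ne_one_iff.mpr ⟨1, hψ⟩)⟩

end Fourier

/-! ### Monomial representations -/

section Monomial

/-- The representation by monomial matrices attached to a right action `σ` of `G` on `X` and a
multiplicative cocycle `k`. -/
def monomialRep {G X : Type*} [Monoid G] [Fintype X] [DecidableEq X] (σ : G → X → X)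
    (k : G → X → ℂ) (hσ1 : ∀ x, σ 1 x = x) (hk1 : ∀ x, k 1 x = 1)
    (hσ : ∀ g h x, σ (g * h) x = σ h (σ g x))
    (hk : ∀ g h x, k (g * h) x = k g x * k h (σ g x)) : G →* Matrix X X ℂ where
  toFun g := Matrix.of fun x y => if y = σ g x then k g x else 0
  map_one' := by
    ext x y
    simp [hσ1, hk1, Matrix.one_apply, eq_comm]
  map_mul' g h := by
    ext x y
    simp only [Matrix.mul_apply, Matrix.of_apply, hσ, hk]
    rw [Finset.sum_eq_single (σ g x)]
    · simp
    · intro j _ hj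
      simp [hj]
    · simp

theorem MonoidAlgebra.lift_eq_sum {G A : Type*} [Monoid G] [Fintype G] [Semiring A] [Algebra ℂ A]
    (ρ : G →* A) (f : MonoidAlgebra ℂ G) :
    MonoidAlgebra.lift ℂ A G ρ f = ∑ g, f.coeff g • ρ g := by
  rw [MonoidAlgebra.lift_apply, Finsupp.sum_fintype _ _ (by simp)]

end Monomial

/-! ### The representations of `Heis F ⋊ (Fˣ × Fˣ)` -/

section HeisenbergRep

variable {F : Type} [Field F]

/-- The scalar by which `diag(u, v, u)` acts on the first Heisenberg coordinate. -/
def heisWeight (p : Fˣ × Fˣ) : Fˣ := p.1⁻¹ * p.2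

theorem heisWeight_mul (p r : Fˣ × Fˣ) : heisWeight (p * r) = heisWeight p * heisWeight r := by
  simp only [heisWeight, Prod.fst_mul, Prod.snd_mul, mul_inv]
  exact mul_mul_mul_comm _ _ _ _

@[simp] theorem heisWeight_one : heisWeight (1 : Fˣ × Fˣ) = 1 := by simp [heisWeight]

@[simp] theorem heisAct_apply_a (p : Fˣ × Fˣ) (x : Heis F) :
    (heisAct F p x).a = heisWeight p * x.a := by simp [heisAct, heisWeight]

@[simp] theorem heisAct_apply_b (p : Fˣ × Fˣ) (x : Heis F) :
    (heisAct F p x).b = ((heisWeight p)⁻¹ : Fˣ) * x.b := by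
  simp [heisAct, heisWeight, mul_comm]

@[simp] theorem heisAct_apply_c (p : Fˣ × Fˣ) (x : Heis F) : (heisAct F p x).c = x.c := by
  simp [heisAct]

/-- The linear representation attached to a character of `Fˣ × Fˣ`. -/
def linearRep (φ : AddChar (Additive (Fˣ × Fˣ)) ℂ) : Heis F ⋊[heisAct F] (Fˣ × Fˣ) →* ℂ where
  toFun g := φ (Additive.ofMul g.right)
  map_one' := by simp
  map_mul' g h := by simp [AddChar.map_add_eq_mul]

/-- Representatives for the nontrivial characters of `F²` modulo `(α, β) ↦ (t⁻¹ α, t β)`. -/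
def orbitRep : Option F → F × F
  | none => (0, 1)
  | some k => (1, k)

variable [Fintype F] [DecidableEq F]

/-- The representation induced from a nontrivial character of `F² × Z`, where `Z` is the kernel
of the weight. -/
def orbitalRep (ψ : AddChar F ℂ) (r : Option F × AddChar (Additive Fˣ) ℂ) :
    Heis F ⋊[heisAct F] (Fˣ × Fˣ) →* Matrix Fˣ Fˣ ℂ :=
  monomialRep (fun g x => (heisWeight g.right)⁻¹ * x)
    (fun g x => r.2 (Additive.ofMul g.right.1) *
      ψ ((orbitRep r.1).1 * ((x⁻¹ : Fˣ) * g.left.a) + (orbitRep r.1).2 * (x * g.left.b)))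
    (by simp) (by simp)
    (fun g h x => by simp only [SemidirectProduct.mul_right, heisWeight_mul]; group)
    (fun g h x => by
      simp only [SemidirectProduct.mul_right, SemidirectProduct.mul_left, Prod.fst_mul, ofMul_mul,
        AddChar.map_add_eq_mul r.2, Heis.mul_a, Heis.mul_b, heisAct_apply_a, heisAct_apply_b]
      rw [mul_mul_mul_comm, ← AddChar.map_add_eq_mul ψ]
      congr 2
      simp only [mul_inv, inv_inv, Units.val_mul]
      ring)

/-- The extension of the Schrödinger representation with central character `ψ (γ ·)`, twisted by
a character of `Fˣ × Fˣ`. -/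
def schrodingerRep (ψ : AddChar F ℂ) (r : Fˣ × AddChar (Additive (Fˣ × Fˣ)) ℂ) :
    Heis F ⋊[heisAct F] (Fˣ × Fˣ) →* Matrix F F ℂ :=
  monomialRep (fun g x => ((heisWeight g.right)⁻¹ : Fˣ) * (x + g.left.a))
    (fun g x => r.2 (Additive.ofMul g.right) * ψ (r.1 * (g.left.c + x * g.left.b)))
    (by simp) (by simp)
    (fun g h x => by
      simp only [SemidirectProduct.mul_right, SemidirectProduct.mul_left, heisWeight_mul,
        Heis.mul_a, heisAct_apply_a, mul_inv, Units.val_mul]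
      have := (heisWeight g.right).inv_mul
      linear_combination (((heisWeight h.right)⁻¹ : Fˣ) * h.left.a : F) * this)
    (fun g h x => by
      simp only [SemidirectProduct.mul_right, SemidirectProduct.mul_left, ofMul_mul,
        AddChar.map_add_eq_mul r.2, Heis.mul_b, Heis.mul_c, heisAct_apply_b, heisAct_apply_c]
      rw [mul_mul_mul_comm, ← AddChar.map_add_eq_mul ψ]
      congr 2
      ring)


/-- Coordinates on `Heis F ⋊ (Fˣ × Fˣ)`, with the torus coordinate first. -/
def heisSemidirectEquiv (F : Type) [Field F] :
    Heis F ⋊[heisAct F] (Fˣ × Fˣ) ≃ (Fˣ × Fˣ) × F × F × F where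
  toFun g := (g.right, g.left.a, g.left.b, g.left.c)
  invFun r := ⟨⟨r.2.1, r.2.2.1, r.2.2.2⟩, r.1⟩
  left_inv _ := rfl
  right_inv _ := rfl

instance : Fintype (Heis F ⋊[heisAct F] (Fˣ × Fˣ)) :=
  Fintype.ofEquiv _ (heisSemidirectEquiv F).symm

theorem sum_heisSemidirect {M : Type*} [AddCommMonoid M]
    (h : Heis F ⋊[heisAct F] (Fˣ × Fˣ) → M) :
    ∑ g, h g = ∑ d, ∑ a, ∑ b, ∑ c, h ⟨⟨a, b, c⟩, d⟩ := by
  rw [Fintype.sum_equiv (heisSemidirectEquiv F) h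
    (fun r => h ((heisSemidirectEquiv F).symm r)) (fun _ => rfl)]
  simp only [Fintype.sum_prod_type]
  rfl

section Injectivity

variable {ψ : AddChar F ℂ} {f : F → F → F → Fˣ × Fˣ → ℂ}

/-- Vanishing of all the Schrödinger transforms, read off coordinatewise. -/
theorem sum_mul_eq_zero_of_schrodinger (hψ : ψ.IsPrimitive)
    (h : ∀ (γ : Fˣ) (φ : AddChar (Additive (Fˣ × Fˣ)) ℂ) (x y : F),
      ∑ d, ∑ a, ∑ b, ∑ c, f a b c d *
        (if y = ((heisWeight d)⁻¹ : Fˣ) * (x + a) then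
          φ (Additive.ofMul d) * ψ (γ * (c + x * b)) else 0) = 0)
    (γ : Fˣ) (a b : F) (d : Fˣ × Fˣ) : ∑ c, f a b c d * ψ (γ * c) = 0 := by
  have h1 (x y : F) (d : Fˣ × Fˣ) : ∑ a, ∑ b, ∑ c, f a b c d *
      (if y = ((heisWeight d)⁻¹ : Fˣ) * (x + a) then ψ (γ * (c + x * b)) else 0) = 0 := by
    refine AddChar.eq_zero_of_forall_sum_mul_ofMul_eq_zero (f := fun d => ∑ a, ∑ b, ∑ c,
      f a b c d *
        (if y = ((heisWeight d)⁻¹ : Fˣ) * (x + a) then ψ (γ * (c + x * b)) else 0))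
      (fun φ => ?_) d
    refine Eq.trans ?_ (h γ φ x y)
    simp only [Finset.sum_mul]
    refine Finset.sum_congr rfl fun d _ => Finset.sum_congr rfl fun a _ =>
      Finset.sum_congr rfl fun b _ => Finset.sum_congr rfl fun c _ => ?_
    split_ifs <;> ring
  have h2 (x : F) : ∑ b, ∑ c, f a b c d * ψ (γ * (c + x * b)) = 0 := by
    have := h1 x (((heisWeight d)⁻¹ : Fˣ) * (x + a)) d
    rw [Finset.sum_eq_single a] at this
    · simpa using this
    · intro a' _ ha'
      simp [ha'.symm]
    · simp
  refine hψ.eq_zero_of_forall_sum_mul_eq_zero (f := fun b => ∑ c, f a b c d * ψ (γ * c))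
    (fun β => ?_) b
  rw [← h2 ((γ⁻¹ : Fˣ) * β)]
  simp only [Finset.sum_mul]
  refine Finset.sum_congr rfl fun b _ => Finset.sum_congr rfl fun c _ => ?_
  rw [mul_assoc, ← AddChar.map_add_eq_mul]
  congr 2
  linear_combination (-β * b) * γ.mul_inv

/-- Vanishing of all the orbital transforms, read off coordinatewise. -/
theorem sum_mul_eq_zero_of_orbital
    (h : ∀ (o : Option F) (ω : AddChar (Additive Fˣ) ℂ) (x y : Fˣ),
      ∑ d, ∑ a, ∑ b, ∑ c, f a b c d *
        (if y = (heisWeight d)⁻¹ * x then ω (Additive.ofMul d.1) *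
          ψ ((orbitRep o).1 * ((x⁻¹ : Fˣ) * a) + (orbitRep o).2 * (x * b)) else 0) = 0)
    (α β : F) (hαβ : α ≠ 0 ∨ β ≠ 0) (d : Fˣ × Fˣ) :
    ∑ a, ∑ b, ∑ c, f a b c d * ψ (α * a + β * b) = 0 := by
  have h1 (o : Option F) (x : Fˣ) : ∑ a, ∑ b, ∑ c, f a b c d *
      ψ ((orbitRep o).1 * ((x⁻¹ : Fˣ) * a) + (orbitRep o).2 * (x * b)) = 0 := by
    have h2 := AddChar.eq_zero_of_forall_sum_mul_ofMul_eq_zero (f := fun u => ∑ v, ∑ a, ∑ b, ∑ c,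
      f a b c (u, v) * (if (heisWeight d)⁻¹ * x = (heisWeight (u, v))⁻¹ * x then
        ψ ((orbitRep o).1 * ((x⁻¹ : Fˣ) * a) + (orbitRep o).2 * (x * b)) else 0))
      (fun ω => ?_) d.1
    · rw [Finset.sum_eq_single d.2] at h2
      · simpa using h2
      · intro v _ hv
        simp [heisWeight, hv.symm]
      · simp
    · refine Eq.trans ?_ (h o ω x ((heisWeight d)⁻¹ * x))
      rw [Fintype.sum_prod_type]
      simp only [Finset.sum_mul]
      refine Finset.sum_congr rfl fun u _ => Finset.sum_congr rfl fun v _ =>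
        Finset.sum_congr rfl fun a _ => Finset.sum_congr rfl fun b _ =>
        Finset.sum_congr rfl fun c _ => ?_
      split_ifs <;> ring
  by_cases hα : α = 0
  · have hβ : β ≠ 0 := hαβ.resolve_left (not_not.mpr hα)
    simpa [orbitRep, hα] using h1 none (Units.mk0 β hβ)
  · have hx (b : F) : β * α * (α⁻¹ * b) = β * b := by field_simp
    simpa [orbitRep, hx] using h1 (some (β * α)) (Units.mk0 α hα)⁻¹

/-- A function on `Heis F ⋊ (Fˣ × Fˣ)` annihilated by all the representations is zero. -/
theorem eq_zero_of_transforms (hψ : ψ.IsPrimitive)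
    (h₁ : ∀ φ : AddChar (Additive (Fˣ × Fˣ)) ℂ,
      ∑ d, ∑ a, ∑ b, ∑ c, f a b c d * φ (Additive.ofMul d) = 0)
    (h₂ : ∀ (o : Option F) (ω : AddChar (Additive Fˣ) ℂ) (x y : Fˣ),
      ∑ d, ∑ a, ∑ b, ∑ c, f a b c d *
        (if y = (heisWeight d)⁻¹ * x then ω (Additive.ofMul d.1) *
          ψ ((orbitRep o).1 * ((x⁻¹ : Fˣ) * a) + (orbitRep o).2 * (x * b)) else 0) = 0)
    (h₃ : ∀ (γ : Fˣ) (φ : AddChar (Additive (Fˣ × Fˣ)) ℂ) (x y : F),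
      ∑ d, ∑ a, ∑ b, ∑ c, f a b c d *
        (if y = ((heisWeight d)⁻¹ : Fˣ) * (x + a) then
          φ (Additive.ofMul d) * ψ (γ * (c + x * b)) else 0) = 0)
    (a b c : F) (d : Fˣ × Fˣ) : f a b c d = 0 := by
  have hlin : ∑ a, ∑ b, ∑ c, f a b c d = 0 := by
    refine AddChar.eq_zero_of_forall_sum_mul_ofMul_eq_zero
      (f := fun d => ∑ a, ∑ b, ∑ c, f a b c d) (fun φ => ?_) d
    simpa only [Finset.sum_mul] using h₁ φ
  have hplane (α β : F) : ∑ a, ∑ b, ∑ c, f a b c d * ψ (α * a + β * b) = 0 := by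
    by_cases hαβ : α = 0 ∧ β = 0
    · simpa [hαβ.1, hαβ.2] using hlin
    · exact sum_mul_eq_zero_of_orbital h₂ α β (not_and_or.mp hαβ) d
  have hcenter (a b : F) : ∑ c, f a b c d = 0 := by
    refine hψ.eq_zero_of_forall_sum_mul_eq_zero (f := fun b => ∑ c, f a b c d) (fun β => ?_) b
    refine hψ.eq_zero_of_forall_sum_mul_eq_zero
      (f := fun a => ∑ b, (∑ c, f a b c d) * ψ (β * b)) (fun α => ?_) a
    rw [← hplane α β]
    simp only [Finset.sum_mul, mul_assoc, ← AddChar.map_add_eq_mul, add_comm]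
  refine hψ.eq_zero_of_forall_sum_mul_eq_zero (f := fun c => f a b c d) (fun γ => ?_) c
  by_cases hγ : γ = 0
  · simpa [hγ] using hcenter a b
  · exact sum_mul_eq_zero_of_schrodinger hψ h₃ (Units.mk0 γ hγ) a b d

end Injectivity

/-- All the irreducible representations together. -/
noncomputable def heisWedderburnHom (ψ : AddChar F ℂ) :
    MonoidAlgebra ℂ (Heis F ⋊[heisAct F] (Fˣ × Fˣ)) →ₐ[ℂ]
      ((AddChar (Additive (Fˣ × Fˣ)) ℂ → ℂ) ×
       (Option F × AddChar (Additive Fˣ) ℂ → Matrix Fˣ Fˣ ℂ) ×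
       (Fˣ × AddChar (Additive (Fˣ × Fˣ)) ℂ → Matrix F F ℂ)) :=
  (AlgHom.pi fun φ => MonoidAlgebra.lift ℂ _ _ (linearRep φ)).prod
    ((AlgHom.pi fun r => MonoidAlgebra.lift ℂ _ _ (orbitalRep ψ r)).prod
      (AlgHom.pi fun r => MonoidAlgebra.lift ℂ _ _ (schrodingerRep ψ r)))

theorem heisWedderburnHom_injective {ψ : AddChar F ℂ} (hψ : ψ.IsPrimitive) :
    Function.Injective (heisWedderburnHom ψ) := by
  rw [injective_iff_map_eq_zero]
  intro f hf
  have hlin (φ) : MonoidAlgebra.lift ℂ _ _ (linearRep φ) f = 0 :=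
    congrFun (congrArg Prod.fst hf) φ
  have horb (r) : MonoidAlgebra.lift ℂ _ _ (orbitalRep ψ r) f = 0 :=
    congrFun (congrArg (fun z => z.2.1) hf) r
  have hsch (r) : MonoidAlgebra.lift ℂ _ _ (schrodingerRep ψ r) f = 0 :=
    congrFun (congrArg (fun z => z.2.2) hf) r
  simp only [MonoidAlgebra.lift_eq_sum, sum_heisSemidirect] at hlin horb hsch
  ext ⟨⟨a, b, c⟩, d⟩
  refine eq_zero_of_transforms (f := fun a b c d => f.coeff ⟨⟨a, b, c⟩, d⟩) hψ
    hlin (fun o ω x y => ?_) (fun γ φ x y => ?_) a b c d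
  · have h := congrFun (congrFun (horb (o, ω)) x) y
    simp only [Matrix.sum_apply, Matrix.smul_apply, smul_eq_mul] at h
    exact h
  · have h := congrFun (congrFun (hsch (γ, φ)) x) y
    simp only [Matrix.sum_apply, Matrix.smul_apply, smul_eq_mul] at h
    exact h

theorem heisWedderburnHom_bijective {ψ : AddChar F ℂ} (hψ : ψ.IsPrimitive) :
    Function.Bijective (heisWedderburnHom ψ) := by
  have hinj := heisWedderburnHom_injective hψ
  have hcard : Fintype.card F = Fintype.card Fˣ + 1 := by
    rw [Fintype.card_units, Nat.sub_add_cancel Fintype.card_pos]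
  have hJ : Fintype.card (Heis F ⋊[heisAct F] (Fˣ × Fˣ)) =
      Fintype.card Fˣ ^ 2 * Fintype.card F ^ 3 := by
    rw [Fintype.card_congr (heisSemidirectEquiv F)]
    simp only [Fintype.card_prod]
    ring
  refine ⟨hinj, (LinearMap.injective_iff_surjective_of_finrank_eq_finrank
    (f := (heisWedderburnHom ψ).toLinearMap) ?_).mp hinj⟩
  rw [(MonoidAlgebra.coeffLinearEquiv ℂ).finrank_eq]
  simp only [Module.finrank_finsupp_self, hJ, Module.finrank_prod, Module.finrank_pi_fintype,
    Module.finrank_matrix, Module.finrank_self, Finset.sum_const, Finset.card_univ,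
    Fintype.card_prod, AddChar.card_eq, Fintype.card_option, Fintype.card_additive, smul_eq_mul,
    hcard]
  ring

end HeisenbergRep

/-- The Wedderburn decomposition of the group algebra of `Heis F ⋊ (Fˣ × Fˣ)`. -/
theorem heisSemidirect_wedderburn (F : Type) [Field F] [Fintype F] (q : ℕ)
    (hq : Fintype.card F = q) :
    Nonempty (MonoidAlgebra ℂ (Heis F ⋊[heisAct F] (Fˣ × Fˣ)) ≃ₐ[ℂ]
      ((Fin ((q - 1) ^ 2) → ℂ) ×
       (Fin ((q + 1) * (q - 1)) → Matrix (Fin (q - 1)) (Fin (q - 1)) ℂ) ×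
       (Fin ((q - 1) ^ 3) → Matrix (Fin q) (Fin q) ℂ))) := by
  classical
  obtain ⟨ψ, hψ⟩ := AddChar.exists_isPrimitive_complex F
  have hu : Fintype.card Fˣ = q - 1 := by rw [Fintype.card_units, hq]
  let e₁ : AddChar (Additive (Fˣ × Fˣ)) ℂ ≃ Fin ((q - 1) ^ 2) := Fintype.equivFinOfCardEq (by
    rw [AddChar.card_eq, Fintype.card_additive, Fintype.card_prod, hu, sq])
  let e₂ : Option F × AddChar (Additive Fˣ) ℂ ≃ Fin ((q + 1) * (q - 1)) :=
    Fintype.equivFinOfCardEq (by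
      rw [Fintype.card_prod, AddChar.card_eq, Fintype.card_additive, Fintype.card_option, hu, hq])
  let e₃ : Fˣ × AddChar (Additive (Fˣ × Fˣ)) ℂ ≃ Fin ((q - 1) ^ 3) :=
    Fintype.equivFinOfCardEq (by
      rw [Fintype.card_prod, AddChar.card_eq, Fintype.card_additive, Fintype.card_prod, hu]
      ring)
  exact ⟨(AlgEquiv.ofBijective _ (heisWedderburnHom_bijective hψ)).trans
    ((AlgEquiv.piCongrLeft' ℂ _ e₁).prodCongr
      (((AlgEquiv.piCongrLeft' ℂ _ e₂).trans
        (AlgEquiv.piCongrRight fun _ =>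
          Matrix.reindexAlgEquiv ℂ ℂ (Fintype.equivFinOfCardEq hu))).prodCongr
      ((AlgEquiv.piCongrLeft' ℂ _ e₃).trans
        (AlgEquiv.piCongrRight fun _ =>
          Matrix.reindexAlgEquiv ℂ ℂ (Fintype.equivFinOfCardEq hq)))))⟩

/-- The degrees in a decomposition of an algebra into complex matrix algebras are unique. -/
theorem AlgEquiv.exists_equiv_matrix_degree_eq {ι κ : Type} [Fintype ι] [Fintype κ]
    {d : ι → ℕ} {m : κ → ℕ} (hd : ∀ i, 1 ≤ d i) (hm : ∀ j, 1 ≤ m j)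
    (Φ : (∀ i, Matrix (Fin (d i)) (Fin (d i)) ℂ) ≃ₐ[ℂ] ∀ j, Matrix (Fin (m j)) (Fin (m j)) ℂ) :
    ∃ σ : ι ≃ κ, ∀ i, d i = m (σ i) := by
  classical
  have (i : ι) : Nonempty (Fin (d i)) := ⟨⟨0, hd i⟩⟩
  have (j : κ) : Nonempty (Fin (m j)) := ⟨⟨0, hm j⟩⟩
  obtain ⟨σ, hσ⟩ := Φ.exists_equiv_finrank_eq
  refine ⟨σ, fun i => Nat.mul_self_inj.mp ?_⟩
  simpa [Module.finrank_matrix] using hσ i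

/-- The algebra of `1 × 1` matrices. -/
def matrixFinOneAlgEquiv : Matrix (Fin 1) (Fin 1) ℂ ≃ₐ[ℂ] ℂ where
  toFun M := M 0 0
  invFun z := Matrix.of fun _ _ => z
  left_inv M := by
    ext i j
    rw [Subsingleton.elim i 0, Subsingleton.elim j 0]
    rfl
  right_inv _ := rfl
  map_mul' M N := by simp [Matrix.mul_apply]
  map_add' _ _ := rfl
  commutes' z := by simp [Matrix.algebraMap_matrix_apply]

/-- **Irreducible characters of `J = Heis(F_q) ⋊ (F_qˣ × F_qˣ)`.**
With `q = |F|` and the coprimality `gcd(q, |D|) = 1` (which always holds), the group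
`J = Heis F ⋊[heisAct F] (Fˣ × Fˣ)` has exactly `(q-1)²` irreducible complex characters of
degree `1`, `(q+1)(q-1)` of degree `q-1`, and `(q-1)³` of degree `q` — equivalently a
Wedderburn decomposition of its complex group algebra as below.  Consequently its
representation zeta function is
`ζ_J(s) = (q-1)·((q-1) + (q+1)(q-1)^{-s} + (q-1)(q-1) q^{-s})`. -/
theorem heisenberg_semidirect_rep_zeta
    (F : Type) [Field F] [Fintype F] (q : ℕ) (hq : Fintype.card F = q)
    (hcop : Nat.Coprime q ((q - 1) ^ 2)) :
    Nonempty (MonoidAlgebra ℂ (Heis F ⋊[heisAct F] (Fˣ × Fˣ)) ≃ₐ[ℂ]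
      ((Fin ((q - 1) ^ 2) → ℂ) ×
       (Fin ((q + 1) * (q - 1)) → Matrix (Fin (q - 1)) (Fin (q - 1)) ℂ) ×
       (Fin ((q - 1) ^ 3) → Matrix (Fin q) (Fin q) ℂ))) ∧
    (∀ (ι : Type) [Fintype ι] (d : ι → ℕ), (∀ i, 1 ≤ d i) →
      Nonempty (MonoidAlgebra ℂ (Heis F ⋊[heisAct F] (Fˣ × Fˣ)) ≃ₐ[ℂ]
        ∀ i, Matrix (Fin (d i)) (Fin (d i)) ℂ) →
      ∀ s : ℂ, ∑ i, ((d i : ℂ)) ^ (-s) =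
        ((q : ℂ) - 1) * (((q : ℂ) - 1) + ((q : ℂ) + 1) * ((q : ℂ) - 1) ^ (-s)
          + ((q : ℂ) - 1) * ((q : ℂ) - 1) * (q : ℂ) ^ (-s))) := by
  have hq2 : 2 ≤ q := hq ▸ Fintype.one_lt_card
  obtain ⟨Ψ⟩ := heisSemidirect_wedderburn F q hq
  refine ⟨⟨Ψ⟩, fun ι _ d hd ⟨Φ⟩ s => ?_⟩
  let m : Fin ((q - 1) ^ 2) ⊕ (Fin ((q + 1) * (q - 1)) ⊕ Fin ((q - 1) ^ 3)) → ℕ :=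
    Sum.elim (fun _ => 1) (Sum.elim (fun _ => q - 1) (fun _ => q))
  have hm : ∀ k, 1 ≤ m k := by
    rintro (_ | _ | _)
    · exact le_rfl
    · exact Nat.le_sub_one_of_lt hq2
    · exact one_le_two.trans hq2
  let Θ : (∀ k, Matrix (Fin (m k)) (Fin (m k)) ℂ) ≃ₐ[ℂ]
      ((Fin ((q - 1) ^ 2) → ℂ) ×
       (Fin ((q + 1) * (q - 1)) → Matrix (Fin (q - 1)) (Fin (q - 1)) ℂ) ×
       (Fin ((q - 1) ^ 3) → Matrix (Fin q) (Fin q) ℂ)) :=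
    (AlgEquiv.sumPiEquivProdPi ℂ fun k => Matrix (Fin (m k)) (Fin (m k)) ℂ).trans
      ((AlgEquiv.piCongrRight fun _ => matrixFinOneAlgEquiv).prodCongr
        (AlgEquiv.sumPiEquivProdPi ℂ fun k =>
          Matrix (Fin (m (Sum.inr k))) (Fin (m (Sum.inr k))) ℂ))
  obtain ⟨σ, hσ⟩ :=
    AlgEquiv.exists_equiv_matrix_degree_eq hd hm ((Φ.symm.trans Ψ).trans Θ.symm)
  rw [Fintype.sum_equiv σ _ (fun k => (m k : ℂ) ^ (-s)) (fun i => by rw [hσ i])]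
  simp only [m, Fintype.sum_sum_type, Sum.elim_inl, Sum.elim_inr, Finset.sum_const,
    Finset.card_univ, Fintype.card_fin, nsmul_eq_mul, Nat.cast_one, Complex.one_cpow,
    Nat.cast_mul, Nat.cast_pow, Nat.cast_add, Nat.cast_sub (one_le_two.trans hq2)]
  ring
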